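/- Let X and Y be locally compact Hausdorff spaces and let π : Y → X be a continuous open surjection. Let Φ be a map assigning to each nonnegative f ∈ C₀(Y) a function Φ(f) : X → [0,∞] such that: (i) Φ(f+g) = Φ(f) + Φ(g) for all nonnegative f, g ∈ C₀(Y); (ii) Φ((h∘π)·f) = h·Φ(f) pointwise for every nonnegative h ∈ C₀(X) and nonnegative f ∈ C₀(Y); (iii) Φ(f) is lower semicontinuous on X for every nonnegative f ∈ C₀(Y); (iv) whenever nonnegative functions f_n ∈ C₀(Y) converge uniformly to f ∈ C₀(Y), one has Φ(f)(x) ≤ liminf_n Φ(f_n)(x) for every x ∈ X; (v) the set P = {f ∈ C₀(Y) : f ≥ 0 and Φ(f) is finite-valued and continuous on X} is dense in the set of nonnegative elements of C₀(Y) for the uniform norm. Then there exists a family (α_x)_{x∈X} of Radon measures on Y such that each α_x is concentrated on the fibre π⁻¹(x), Φ(f)(x) = ∫⁻ f dα_x for every nonnegative f ∈ C₀(Y) and every x ∈ X, and for every continuous compactly supported f : Y → ℝ the map x ↦ ∫ f dα_x is continuous (that is, (α_x) is a continuous π-system of measures). -/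

import Mathlib

open scoped ENNReal ZeroAtInfty
open MeasureTheory Filter

open scoped NNReal CompactlySupported Topology

namespace PiSystemAux

/-- A continuous compactly supported function as an element of `C₀`. -/
def ofCc {Z : Type*} [TopologicalSpace Z] (f : Z → ℝ) (hf : Continuous f)
    (hc : HasCompactSupport f) : C₀(Z, ℝ) where
  toFun := f
  continuous_toFun := hf
  zero_at_infty' := hc.is_zero_at_infty

theorem ofCc_apply {Z : Type*} [TopologicalSpace Z] (f : Z → ℝ) (hf : Continuous f)
    (hc : HasCompactSupport f) (z : Z) : ofCc f hf hc z = f z := rfl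

theorem exists_pull {X Y : Type*} [TopologicalSpace X] [TopologicalSpace Y]
    (π : Y → X) (hπ : Continuous π) (h : X → ℝ) (hc : Continuous h)
    (h01 : ∀ x, h x ∈ Set.Icc (0 : ℝ) 1) (f : C₀(Y, ℝ)) :
    ∃ g : C₀(Y, ℝ), ∀ y, g y = h (π y) * f y := by
  refine ⟨⟨⟨fun y => h (π y) * f y, (hc.comp hπ).mul f.continuous⟩, ?_⟩, fun y => rfl⟩
  refine squeeze_zero_norm (a := fun y => ‖f y‖) (fun y => ?_) ?_
  · have := h01 (π y)
    show ‖h (π y) * f y‖ ≤ _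
    rw [norm_mul, Real.norm_of_nonneg this.1]
    exact mul_le_of_le_one_left (norm_nonneg _) this.2
  · simpa using f.zero_at_infty'.norm

theorem continuous_of_add {X : Type*} [TopologicalSpace X] {a b c : X → ℝ≥0∞}
    (ha : LowerSemicontinuous a) (hb : LowerSemicontinuous b) (hc : Continuous c)
    (hfin : ∀ x, c x ≠ ∞) (h : ∀ x, a x + b x = c x) : Continuous a := by
  rw [continuous_iff_lower_upperSemicontinuous]
  refine ⟨ha, ?_⟩
  intro x0 y hy
  have hbfin : ∀ x, b x ≠ ∞ := fun x hx => hfin x (by rw [← h x, hx, add_top])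
  obtain ⟨ε, hε, hε2⟩ : ∃ ε : ℝ≥0, 0 < ε ∧ a x0 + ε < y := by
    obtain ⟨ε, hε, h2⟩ := ENNReal.lt_iff_exists_add_pos_lt.1 hy
    exact ⟨ε, hε, h2⟩
  have hε' : (ε : ℝ≥0∞) / 2 ≠ 0 := by
    simpa using hε.ne'
  have h1 : ∀ᶠ x in 𝓝 x0, b x0 ≤ b x + ε / 2 := by
    by_cases h0 : b x0 = 0
    · exact Eventually.of_forall fun x => by simp [h0]
    · filter_upwards [hb x0 (b x0 - ε / 2) (ENNReal.sub_lt_self (hbfin x0) h0 hε')] with x hx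
      exact tsub_le_iff_right.1 hx.le
  have h2 : ∀ᶠ x in 𝓝 x0, c x < c x0 + ε / 2 :=
    hc.continuousAt.eventually_lt_const (ENNReal.lt_add_right (hfin x0) hε')
  filter_upwards [h1, h2] with x hx1 hx2
  refine lt_of_le_of_lt ?_ hε2
  refine (ENNReal.add_le_add_iff_right (hbfin x)).1 ?_
  calc a x + b x = c x := h x
    _ ≤ c x0 + ε / 2 := hx2.le
    _ = a x0 + b x0 + ε / 2 := by rw [h]
    _ ≤ a x0 + (b x + ε / 2) + ε / 2 := by gcongr
    _ = a x0 + (ε / 2 + ε / 2) + b x := by ring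
    _ = a x0 + ε + b x := by rw [ENNReal.add_halves]

end PiSystemAux

open PiSystemAux

/-- Let `π : Y → X` be a continuous open surjection between locally
compact Hausdorff spaces, and let `Φ` assign to each nonnegative `f ∈ C₀(Y)` a
function `Φ f : X → [0,∞]` which is additive, `C₀(X)`-homogeneous (via `π`), lower
semicontinuous in both senses, and densely defined.  Then `Φ` is given by integration
against a continuous `π`-system `(α x)_{x∈X}` of Radon measures concentrated on the
fibres. -/
theorem exists_continuous_pi_system_of_weight
    {X Y : Type*} [TopologicalSpace X] [LocallyCompactSpace X] [T2Space X]
    [TopologicalSpace Y] [LocallyCompactSpace Y] [T2Space Y]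
    [MeasurableSpace Y] [BorelSpace Y]
    (π : Y → X) (hπ : Continuous π) (hopen : IsOpenMap π) (hsurj : Function.Surjective π)
    (Φ : C₀(Y, ℝ) → X → ℝ≥0∞)
    -- (i) additivity
    (hadd : ∀ f g : C₀(Y, ℝ), (∀ y, 0 ≤ f y) → (∀ y, 0 ≤ g y) →
      Φ (f + g) = Φ f + Φ g)
    -- (ii) C₀(X)-homogeneity: if g = (h ∘ π) · f then Φ g = h · Φ f
    (hmul : ∀ h : C₀(X, ℝ), (∀ x, 0 ≤ h x) → ∀ f : C₀(Y, ℝ), (∀ y, 0 ≤ f y) →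
      ∀ g : C₀(Y, ℝ), (∀ y, g y = h (π y) * f y) →
      ∀ x, Φ g x = ENNReal.ofReal (h x) * Φ f x)
    -- (iii) each Φ f is lower semicontinuous on X
    (hlscX : ∀ f : C₀(Y, ℝ), (∀ y, 0 ≤ f y) → LowerSemicontinuous (Φ f))
    -- (iv) Φ is lower semicontinuous w.r.t. uniform convergence
    (hlscU : ∀ (fn : ℕ → C₀(Y, ℝ)) (f : C₀(Y, ℝ)), (∀ n y, 0 ≤ fn n y) →
      (∀ y, 0 ≤ f y) → TendstoUniformly (fun n y => fn n y) (fun y => f y) atTop →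
      ∀ x, Φ f x ≤ liminf (fun n => Φ (fn n) x) atTop)
    -- (v) the domain of Φ is dense in the nonnegative part of C₀(Y)
    (hdense : ∀ f : C₀(Y, ℝ), (∀ y, 0 ≤ f y) →
      f ∈ closure {g : C₀(Y, ℝ) |
        (∀ y, 0 ≤ g y) ∧ (∀ x, Φ g x ≠ ∞) ∧ Continuous (Φ g)}) :
    ∃ α : X → Measure Y,
      (∀ x, (α x).Regular) ∧
      (∀ x, α x (π ⁻¹' {x})ᶜ = 0) ∧
      (∀ f : C₀(Y, ℝ), (∀ y, 0 ≤ f y) → ∀ x,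
        Φ f x = ∫⁻ y, ENNReal.ofReal (f y) ∂α x) ∧
      (∀ f : Y → ℝ, Continuous f → HasCompactSupport f →
        Continuous fun x => ∫ y, f y ∂α x) := by
  have hmono : ∀ f g : C₀(Y, ℝ), (∀ y, 0 ≤ f y) → (∀ y, f y ≤ g y) → ∀ x, Φ f x ≤ Φ g x := by
    intro f g hf hfg x
    have : g = f + (g - f) := by abel
    rw [this, hadd f (g - f) hf (fun y => by simpa using hfg y)]
    exact le_self_add
  have hsmul : ∀ (c : ℝ), 0 ≤ c → ∀ f : C₀(Y, ℝ), (∀ y, 0 ≤ f y) → ∀ x,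
      Φ (c • f) x = ENNReal.ofReal c * Φ f x := by
    intro c hc f hf x
    obtain ⟨h, h1, -, hcs, h01⟩ := exists_continuous_one_zero_of_isCompact
      (isCompact_singleton (x := x)) isClosed_empty (Set.disjoint_empty _)
    have hx : h x = 1 := h1 rfl
    obtain ⟨g, hg⟩ := exists_pull π hπ h h.continuous h01 (c • f)
    have e1 := hmul (ofCc h h.continuous hcs) (fun x => (h01 x).1) (c • f)
      (fun y => mul_nonneg hc (hf y)) g hg x
    have e2 := hmul (c • ofCc h h.continuous hcs) (fun x => mul_nonneg hc (h01 x).1) f hf g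
      (fun y => by
        rw [hg y]; simp only [ZeroAtInftyContinuousMap.smul_apply, ofCc_apply, smul_eq_mul]; ring) x
    rw [e1] at e2
    simpa [ofCc_apply, hx] using e2
  have hkey : ∀ f : C₀(Y, ℝ), (∀ y, 0 ≤ f y) → HasCompactSupport f →
      (∀ x, Φ f x ≠ ∞) ∧ Continuous (Φ f) := by
    intro f hf hcs
    obtain ⟨k, k1, -, kcs, k01⟩ := exists_continuous_one_zero_of_isCompact
      (s := tsupport f) hcs isClosed_empty (Set.disjoint_empty _)
    obtain ⟨g, ⟨hg0, hgfin, hgc⟩, hgd⟩ := Metric.mem_closure_iff.1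
      (hdense (ofCc k k.continuous kcs) (fun y => (k01 y).1)) (1/2) (by norm_num)
    have hgy : ∀ y ∈ tsupport f, 1/2 ≤ g y := by
      intro y hy
      have h1 : dist (ofCc k k.continuous kcs y) (g y) < 1/2 := by
        refine lt_of_le_of_lt ?_ hgd
        rw [← ZeroAtInftyContinuousMap.dist_toBCF_eq_dist]
        exact BoundedContinuousFunction.dist_coe_le_dist (f := (ofCc k k.continuous kcs).toBCF)
          (g := g.toBCF) y
      have h2 : k y = 1 := k1 hy
      rw [ofCc_apply, h2, Real.dist_eq, abs_lt] at h1
      linarith [h1.2]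
    obtain ⟨M, hM⟩ : ∃ M : ℝ, ∀ y, ‖f y‖ ≤ M := ⟨‖f.toBCF‖, fun y => f.toBCF.norm_coe_le_norm y⟩
    set c : ℝ := 2 * |M| with hcdef
    have hc0 : 0 ≤ c := by positivity
    have hle : ∀ y, f y ≤ (c • g) y := by
      intro y
      rw [ZeroAtInftyContinuousMap.smul_apply, smul_eq_mul]
      by_cases hy : y ∈ tsupport f
      · have h1 := hgy y hy
        have h2 : f y ≤ |M| := (le_abs_self _).trans ((hM y).trans (le_abs_self _))
        nlinarith [abs_nonneg M]
      · rw [image_eq_zero_of_notMem_tsupport hy]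
        exact mul_nonneg hc0 (hg0 y)
    have hcfin : ∀ x, Φ (c • g) x ≠ ∞ := fun x => by
      rw [hsmul c hc0 g hg0]
      exact ENNReal.mul_ne_top ENNReal.ofReal_ne_top (hgfin x)
    have hccont : Continuous (Φ (c • g)) := by
      have : Φ (c • g) = fun x => ENNReal.ofReal c * Φ g x := funext (hsmul c hc0 g hg0)
      rw [this]
      exact ENNReal.continuous_const_mul ENNReal.ofReal_ne_top |>.comp hgc
    have hsub0 : ∀ y, 0 ≤ (c • g - f) y := fun y => by
      rw [ZeroAtInftyContinuousMap.sub_apply]; exact sub_nonneg.2 (hle y)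
    have hsum : ∀ x, Φ f x + Φ (c • g - f) x = Φ (c • g) x := by
      intro x
      rw [← Pi.add_apply, ← hadd f _ hf hsub0]
      congr 1
      abel_nf
    exact ⟨fun x => ne_top_of_le_ne_top (hcfin x) (hmono f _ hf hle x),
      continuous_of_add (hlscX f hf) (hlscX _ hsub0) hccont hcfin hsum⟩
  -- embedding of nonnegative compactly supported functions
  let J : C_c(Y, ℝ≥0) → C₀(Y, ℝ) := fun f => ofCc (fun y => (f y : ℝ))
    (NNReal.continuous_coe.comp f.continuous)
    (f.hasCompactSupport.comp_left (g := fun t : ℝ≥0 => (t : ℝ)) rfl)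
  have hJ : ∀ f y, J f y = (f y : ℝ) := fun f y => rfl
  have hJ0 : ∀ f y, 0 ≤ J f y := fun f y => (f y).2
  have hJcs : ∀ f, HasCompactSupport (J f) := fun f =>
    (f.hasCompactSupport.comp_left (g := fun t : ℝ≥0 => (t : ℝ)) rfl)
  let Λ : X → (C_c(Y, ℝ≥0) →ₗ[ℝ≥0] ℝ≥0) := fun x =>
    { toFun := fun f => (Φ (J f) x).toNNReal
      map_add' := fun f g => by
        have : J (f + g) = J f + J g := by
          ext y; simp [hJ]
        rw [this, hadd _ _ (hJ0 f) (hJ0 g), Pi.add_apply,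
          ENNReal.toNNReal_add ((hkey _ (hJ0 f) (hJcs f)).1 x) ((hkey _ (hJ0 g) (hJcs g)).1 x)]
      map_smul' := fun c f => by
        have : J (c • f) = (c : ℝ) • J f := by
          ext y; simp [hJ]
        rw [this, hsmul (c : ℝ) c.coe_nonneg _ (hJ0 f)]
        simp }
  let α : X → Measure Y := fun x => NNRealRMK.rieszMeasure (Λ x)
  have hreg : ∀ x, (α x).Regular := fun x => NNRealRMK.rieszMeasure_regular (Λ x)
  have hrep : ∀ f : C₀(Y, ℝ), (∀ y, 0 ≤ f y) → HasCompactSupport f → ∀ x,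
      ∫⁻ y, ENNReal.ofReal (f y) ∂α x = Φ f x := by
    intro f hf hcs x
    let F : C_c(Y, ℝ≥0) := ⟨⟨fun y => (f y).toNNReal, by fun_prop⟩,
      hcs.comp_left (g := Real.toNNReal) Real.toNNReal_zero⟩
    have hF : J F = f := by
      ext y
      exact Real.coe_toNNReal _ (hf y)
    have h1 : ∫⁻ y, (F y : ℝ≥0∞) ∂α x = ((Φ (J F) x).toNNReal : ℝ≥0∞) :=
      NNRealRMK.lintegral_rieszMeasure (Λ x) F
    rw [hF, ENNReal.coe_toNNReal ((hkey f hf hcs).1 x)] at h1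
    exact h1
  refine ⟨α, hreg, ?_, ?_, ?_⟩
  · intro x
    have hU : IsOpen (π ⁻¹' {x})ᶜ := (isClosed_singleton.preimage hπ).isOpen_compl
    haveI := hreg x
    rw [hU.measure_eq_iSup_isCompact]
    simp only [ENNReal.iSup_eq_zero]
    intro K hKU hK
    obtain ⟨k, k1, -, kcs, k01⟩ := exists_continuous_one_zero_of_isCompact
      hK isClosed_empty (Set.disjoint_empty _)
    obtain ⟨h, h1, h0, hcs, h01⟩ := exists_continuous_one_zero_of_isCompact
      (hK.image hπ) (isClosed_singleton (x := x)) (by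
        rw [Set.disjoint_singleton_right]
        rintro ⟨y, hy, hyx⟩
        exact hKU hy hyx)
    obtain ⟨g, hg⟩ := exists_pull π hπ h h.continuous h01 (ofCc k k.continuous kcs)
    have hg0 : ∀ y, 0 ≤ g y := fun y => by
      rw [hg]; exact mul_nonneg (h01 _).1 (k01 y).1
    have hgcs : HasCompactSupport g := by
      have : (g : Y → ℝ) = (fun y => h (π y)) * k := funext hg
      rw [this]
      exact kcs.mul_left
    have e := hmul (ofCc h h.continuous hcs) (fun x => (h01 x).1) (ofCc k k.continuous kcs)
      (fun y => (k01 y).1) g hg x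
    have hx : h x = 0 := h0 rfl
    rw [ofCc_apply, hx, ENNReal.ofReal_zero, zero_mul, ← hrep g hg0 hgcs x] at e
    refine le_antisymm ?_ bot_le
    calc α x K = ∫⁻ y, K.indicator 1 y ∂α x := by rw [lintegral_indicator_one hK.measurableSet]
      _ ≤ ∫⁻ y, ENNReal.ofReal (g y) ∂α x := by
        refine lintegral_mono fun y => ?_
        by_cases hy : y ∈ K
        · have a1 : k y = 1 := k1 hy
          have a2 : h (π y) = 1 := h1 ⟨y, hy, rfl⟩
          simp [hy, hg, ofCc_apply, a1, a2]
        · simp [hy]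
      _ = 0 := e
  · intro f hf x
    have hcpt : ∀ n : ℕ, HasCompactSupport fun y => max (f y - 1 / ((n : ℝ) + 1)) 0 := by
      intro n
      have hpos : (0 : ℝ) < 1 / ((n : ℝ) + 1) := by positivity
      have hev : ∀ᶠ y in cocompact Y, f y < 1 / ((n : ℝ) + 1) :=
        f.zero_at_infty'.eventually_lt_const hpos
      obtain ⟨K, hK, hKs⟩ := mem_cocompact.1 hev
      refine HasCompactSupport.intro hK fun y hy => ?_
      have : f y < 1 / ((n : ℝ) + 1) := hKs hy
      exact max_eq_right (by linarith)
    let fn : ℕ → C₀(Y, ℝ) := fun n => ofCc (fun y => max (f y - 1 / ((n : ℝ) + 1)) 0)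
      (by fun_prop) (hcpt n)
    have hfn : ∀ n y, fn n y = max (f y - 1 / ((n : ℝ) + 1)) 0 := fun n y => rfl
    have hfn0 : ∀ n y, 0 ≤ fn n y := fun n y => le_max_right _ _
    have hpos : ∀ n : ℕ, (0 : ℝ) < 1 / ((n : ℝ) + 1) := fun n => by positivity
    have hfnle : ∀ n y, fn n y ≤ f y := fun n y => by
      rw [hfn]; exact max_le (by linarith [hpos n]) (hf y)
    have hunif : TendstoUniformly (fun n y => fn n y) (fun y => f y) atTop := by
      rw [Metric.tendstoUniformly_iff]
      intro ε hε
      filter_upwards [(tendsto_one_div_add_atTop_nhds_zero_nat (𝕜 := ℝ)).eventually_lt_const hε]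
        with n hn y
      have h1 := hfnle n y
      have h2 : f y - 1 / ((n : ℝ) + 1) ≤ fn n y := le_max_left _ _
      rw [Real.dist_eq, abs_of_nonneg (by linarith)]
      linarith
    have hint : ∀ n, ∫⁻ y, ENNReal.ofReal (fn n y) ∂α x = Φ (fn n) x :=
      fun n => hrep (fn n) (hfn0 n) (hcpt n) x
    apply le_antisymm
    · refine (hlscU fn f hfn0 hf hunif x).trans ?_
      refine (liminf_le_liminf (v := fun _ => ∫⁻ y, ENNReal.ofReal (f y) ∂α x)
        (Eventually.of_forall fun n => ?_)).trans (le_of_eq (liminf_const _))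
      show Φ (fn n) x ≤ _
      rw [← hint n]
      exact lintegral_mono fun y => ENNReal.ofReal_le_ofReal (hfnle n y)
    · calc ∫⁻ y, ENNReal.ofReal (f y) ∂α x
          = ∫⁻ y, liminf (fun n => ENNReal.ofReal (fn n y)) atTop ∂α x := by
            refine lintegral_congr fun y => ?_
            exact (((ENNReal.continuous_ofReal.tendsto _).comp
              (hunif.tendsto_at y)).liminf_eq).symm
        _ ≤ liminf (fun n => ∫⁻ y, ENNReal.ofReal (fn n y) ∂α x) atTop :=
            lintegral_liminf_le fun n => by
              have := (fn n).continuous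
              exact (ENNReal.continuous_ofReal.comp this).measurable
        _ = liminf (fun n => Φ (fn n) x) atTop := by simp only [hint]
        _ ≤ liminf (fun _ : ℕ => Φ f x) atTop :=
            liminf_le_liminf (Eventually.of_forall fun n => hmono _ _ (hfn0 n) (hfnle n) x)
        _ = Φ f x := liminf_const _
  · intro f hf hcs
    have hp : HasCompactSupport fun y => max (f y) 0 :=
      hcs.comp_left (g := fun t : ℝ => max t 0) (by simp)
    have hn : HasCompactSupport fun y => max (-f y) 0 :=
      hcs.comp_left (g := fun t : ℝ => max (-t) 0) (by simp)
    let p : C₀(Y, ℝ) := ofCc _ (by fun_prop) hp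
    let q : C₀(Y, ℝ) := ofCc _ (by fun_prop) hn
    have hp0 : ∀ y, 0 ≤ p y := fun y => le_max_right _ _
    have hq0 : ∀ y, 0 ≤ q y := fun y => le_max_right _ _
    have heq : (fun x => ∫ y, f y ∂α x) = fun x => (Φ p x).toReal - (Φ q x).toReal := by
      funext x
      haveI := hreg x
      rw [integral_eq_lintegral_pos_part_sub_lintegral_neg_part
        (hf.integrable_of_hasCompactSupport hcs), ← hrep p hp0 hp x, ← hrep q hq0 hn x]
      congr 2
      · refine lintegral_congr fun y => ?_
        show _ = ENNReal.ofReal (max (f y) 0)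
        simp [ENNReal.ofReal, Real.toNNReal]
      · refine lintegral_congr fun y => ?_
        show _ = ENNReal.ofReal (max (-f y) 0)
        simp [ENNReal.ofReal, Real.toNNReal]
    rw [heq]
    have hc : ∀ g : C₀(Y, ℝ), (∀ y, 0 ≤ g y) → HasCompactSupport g →
        Continuous fun x => (Φ g x).toReal := fun g hg hgc => by
      obtain ⟨h1, h2⟩ := hkey g hg hgc
      exact continuous_iff_continuousAt.2 fun x =>
        (ENNReal.tendsto_toReal (h1 x)).comp h2.continuousAt
    exact (hc p hp0 hp).sub (hc q hq0 hn)
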